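/- arXiv:0711.2838 — 3 statements merged into one kernel-verified Lean document; each statement's English description precedes it below -/
import Mathlib

section
/- Let d, k, and ℓ_i be nonnegative integers with (d−1)k ≤ ℓ_i < dk, and let 𝓒_{≥i} be the recursively defined circuit family for the graded sparsity parameters (k, ℓ_i < ℓ_{i+1} < ⋯ < ℓ_s). Then every member of 𝓒_{≥i} either consists of a single edge or has all of its edges of dimension at least d. -/
open Multiset

/-- The set of vertices spanned by a multiset of hyperedges. -/
def spanned {V : Type*} [DecidableEq V] (F : Multiset (Finset V)) : Finset V :=
  F.toFinset.sup id

/-- A hypergraph (given by its edge multiset) is `(k,ℓ)`-sparse if every nonempty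
edge-induced subgraph with `m'` edges spanning `n'` vertices satisfies `m' + ℓ ≤ k n'`. -/
def Sparse {V : Type*} [DecidableEq V] (k ℓ : ℕ) (E : Multiset (Finset V)) : Prop :=
  ∀ F : Multiset (Finset V), F ≤ E → F ≠ 0 → F.card + ℓ ≤ k * (spanned F).card

/-- A `(k,ℓ)`-circuit: a hypergraph on `n'` vertices with exactly `k n' - ℓ + 1` edges,
every proper edge-induced subgraph of which is `(k,ℓ)`-sparse. -/
def IsCircuit {V : Type*} [DecidableEq V] (k ℓ : ℕ) (C : Multiset (Finset V)) : Prop :=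
  C.card + ℓ = k * (spanned C).card + 1 ∧
  ∀ F : Multiset (Finset V), F < C → Sparse k ℓ F

/-- The recursively defined graded circuit family `𝓒_{≥ i}`. -/
def CGE {V : Type*} [DecidableEq V] (k : ℕ) (ℓv : ℕ → ℕ)
    (gr : ℕ → Multiset (Finset V)) (s : ℕ) (i : ℕ) : Set (Multiset (Finset V)) :=
  if h : s ≤ i then {C | C ≤ gr s ∧ IsCircuit k (ℓv s) C}
  else {C | C ∈ CGE k ℓv gr s (i + 1) ∨
    (C ≤ gr i ∧ IsCircuit k (ℓv i) C ∧ ∀ D ∈ CGE k ℓv gr s (i + 1), ¬ D ≤ C)}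
  termination_by s - i
  decreasing_by omega

theorem spanned_singleton {V : Type*} [DecidableEq V] (e : Finset V) :
    spanned ({e} : Multiset (Finset V)) = e := by
  simp [spanned]

/-- An edge of a circuit with more than one edge satisfies the single-edge sparsity bound. -/
theorem IsCircuit.lt_mul_card_of_mem {V : Type*} [DecidableEq V] {k ℓ : ℕ}
    {C : Multiset (Finset V)} (hC : IsCircuit k ℓ C) (hcard : C.card ≠ 1)
    {e : Finset V} (he : e ∈ C) : ℓ < k * e.card := by
  have hlt : ({e} : Multiset (Finset V)) < C :=
    lt_of_le_of_ne (singleton_le.2 he) (by rintro rfl; simp at hcard)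
  have h := hC.2 _ hlt _ le_rfl (singleton_ne_zero e)
  rw [spanned_singleton, card_singleton] at h
  omega

/-- A member of `𝓒_{≥ i}` is a `(k,ℓ_j)`-circuit for some `j` between `i` and `s`. -/
theorem exists_isCircuit_of_mem_CGE {V : Type*} [DecidableEq V] {k s i : ℕ} {ℓv : ℕ → ℕ}
    {gr : ℕ → Multiset (Finset V)} {C : Multiset (Finset V)} (his : i ≤ s)
    (hC : C ∈ CGE k ℓv gr s i) : ∃ j, i ≤ j ∧ j ≤ s ∧ IsCircuit k (ℓv j) C := by
  induction his using Nat.decreasingInduction with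
  | self =>
    rw [CGE, dif_pos le_rfl] at hC
    exact ⟨s, le_rfl, le_rfl, hC.2⟩
  | of_succ i hlt ih =>
    rw [CGE, dif_neg (by omega)] at hC
    rcases hC with hC | hC
    · obtain ⟨j, hij, hjs, h⟩ := ih hC
      exact ⟨j, by omega, hjs, h⟩
    · exact ⟨i, le_rfl, hlt.le, hC.2.1⟩

/-- If `(d-1)k ≤ ℓᵢ < dk`, then every member of the graded circuit family `𝓒_{≥ i}`
is either a single edge or has only edges of dimension at least `d`. -/
theorem cge_circuit_dimension {V : Type*} [DecidableEq V] (d k s i : ℕ)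
    (hi : 1 ≤ i) (his : i ≤ s) (ℓv : ℕ → ℕ) (gr : ℕ → Multiset (Finset V))
    (hl : ∀ a, 1 ≤ a → a < s → ℓv a < ℓv (a + 1))
    (hgr : ∀ a, 1 ≤ a → a < s → gr (a + 1) < gr a)
    (hd1 : (d - 1) * k ≤ ℓv i) (hd2 : ℓv i < d * k) :
    ∀ C ∈ CGE k ℓv gr s i, C.card = 1 ∨ ∀ e ∈ C, d ≤ e.card := by
  intro C hC
  obtain ⟨j, hij, hjs, hcirc⟩ := exists_isCircuit_of_mem_CGE his hC
  have hmono : ℓv i ≤ ℓv j := by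
    clear hcirc
    induction j, hij using Nat.le_induction with
    | base => exact le_rfl
    | succ n hn ih => exact (ih (by omega)).trans (hl n (by omega) (by omega)).le
  refine or_iff_not_imp_left.2 fun hcard e he => ?_
  have h : k * (d - 1) < k * e.card := by
    rw [mul_comm k (d - 1)]
    exact (hd1.trans hmono).trans_lt (hcirc.lt_mul_card_of_mem hcard he)
  have := Nat.lt_of_mul_lt_mul_left h
  omega
end

section
/- Let k and ℓ_i ≤ ℓ_j be nonnegative integers, let C_i be a (k,ℓ_i)-circuit and C_j a (k,ℓ_j)-circuit, and suppose C_i and C_j share an edge y such that C_i ∩ C_j is a proper sub-multiset of the edges of C_j and the number of edges of C_i ∩ C_j satisfies m_∩ ≤ k·n_∩ − ℓ_j, where n_∩ is the number of vertices spanned by C_i ∩ C_j. Then the number m_∪ of edges of C_i ∪ C_j satisfies m_∪ ≥ k·n_∪ − ℓ_i + 2, where n_∪ is the number of vertices spanned by C_i ∪ C_j; in particular, C_i ∪ C_j is not (k,ℓ_i)-sparse. -/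
open Multiset

theorem spanned_mono {V : Type*} [DecidableEq V] {F G : Multiset (Finset V)} (h : F ≤ G) :
    spanned F ⊆ spanned G :=
  Finset.sup_mono (Multiset.toFinset_subset.mpr (Multiset.subset_of_le h))

theorem spanned_union {V : Type*} [DecidableEq V] (F G : Multiset (Finset V)) :
    spanned (F ∪ G) = spanned F ∪ spanned G := by
  simp only [spanned, Multiset.toFinset_union, Finset.sup_union, Finset.sup_eq_union]

theorem Multiset.card_union_add_card_inter {α : Type*} [DecidableEq α] (s t : Multiset α) :
    (s ∪ t).card + (s ∩ t).card = s.card + t.card := by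
  rw [← Multiset.card_add, Multiset.union_add_inter, Multiset.card_add]

/-- Circuit union count: if `Cᵢ` is a `(k,ℓᵢ)`-circuit, `Cⱼ` a `(k,ℓⱼ)`-circuit with
`ℓᵢ ≤ ℓⱼ`, sharing an edge `y`, with `Cᵢ ∩ Cⱼ` a proper sub-multiset of `Cⱼ` whose edge
count satisfies `m∩ + ℓⱼ ≤ k·n∩`, then `m∪ + ℓᵢ ≥ k·n∪ + 2`; in particular `Cᵢ ∪ Cⱼ`
is not `(k,ℓᵢ)`-sparse. -/
theorem circuit_union_not_sparse {V : Type*} [DecidableEq V] (k li lj : ℕ) (hl : li ≤ lj)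
    (Ci Cj : Multiset (Finset V)) (y : Finset V)
    (hCi : IsCircuit k li Ci) (hCj : IsCircuit k lj Cj)
    (hyi : y ∈ Ci) (hyj : y ∈ Cj)
    (hproper : Ci ∩ Cj < Cj)
    (hcap : (Ci ∩ Cj).card + lj ≤ k * (spanned (Ci ∩ Cj)).card) :
    k * (spanned (Ci ∪ Cj)).card + 2 ≤ (Ci ∪ Cj).card + li ∧
      ¬ Sparse k li (Ci ∪ Cj) := by
  have hcount : k * (spanned (Ci ∪ Cj)).card + 2 ≤ (Ci ∪ Cj).card + li := by
    have hedges := Multiset.card_union_add_card_inter Ci Cj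
    have hspan : (spanned (Ci ∩ Cj)).card ≤ (spanned Ci ∩ spanned Cj).card :=
      Finset.card_le_card (Finset.subset_inter (spanned_mono Multiset.inter_le_left)
        (spanned_mono Multiset.inter_le_right))
    have hverts := Finset.card_union_add_card_inter (spanned Ci) (spanned Cj)
    rw [← spanned_union] at hverts
    have hmul := congrArg (k * ·) hverts
    simp only [mul_add] at hmul
    have hle := Nat.mul_le_mul_left k hspan
    have hi := hCi.1
    have hj := hCj.1
    omega
  refine ⟨hcount, fun hsparse => ?_⟩
  have hne : Ci ∪ Cj ≠ 0 := fun h => by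
    have hy : y ∈ Ci ∪ Cj := Multiset.mem_union.mpr (Or.inl hyi)
    simp [h] at hy
  have := hsparse _ le_rfl hne
  omega
end

section
/- Fix nonnegative integers k and ℓ₁ < ℓ₂ < ⋯ < ℓ_s and a graded ground set, and let 𝓒 be the recursively defined circuit family for (k,𝓵)-graded sparsity. If C_i and C_j are members of 𝓒 sharing a common edge y, then the edge multiset (C_i ∪ C_j) − y contains a member of 𝓒 as a subgraph. Consequently 𝓒 satisfies the circuit elimination axiom for matroids. -/
open Multiset

theorem card_spanned_union_add_card_spanned_inter_le {V : Type*} [DecidableEq V]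
    (F G : Multiset (Finset V)) :
    (spanned (F ∪ G)).card + (spanned (F ∩ G)).card ≤ (spanned F).card + (spanned G).card := by
  rw [spanned_union, ← Finset.card_union_add_card_inter (spanned F) (spanned G)]
  gcongr
  exact Finset.subset_inter (spanned_mono Multiset.inter_le_left)
    (spanned_mono Multiset.inter_le_right)

theorem card_spanned_mono {V : Type*} [DecidableEq V] {F G : Multiset (Finset V)} (h : F ≤ G)
    (k : ℕ) : k * (spanned F).card ≤ k * (spanned G).card :=
  Nat.mul_le_mul_left k (Finset.card_le_card (spanned_mono h))

/-- Circuits of a fixed level form an antichain, apart from the empty multiset. -/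
theorem IsCircuit.eq_of_le {V : Type*} [DecidableEq V] {k ℓ : ℕ} {A B : Multiset (Finset V)}
    (hA : IsCircuit k ℓ A) (hB : IsCircuit k ℓ B) (hA0 : A ≠ 0) (hAB : A ≤ B) : A = B := by
  by_contra hne
  have h := hB.2 A (lt_of_le_of_ne hAB hne) A le_rfl hA0
  have := hA.1
  omega

theorem IsCircuit.le_card_of_mem {V : Type*} [DecidableEq V] {k ℓ : ℕ} {C : Multiset (Finset V)}
    (hC : IsCircuit k ℓ C) {e : Finset V} (he : e ∈ C) :
    ℓ ≤ k * (spanned {e}).card := by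
  rcases (Multiset.singleton_le.2 he).eq_or_lt with h | h
  · have := hC.1
    rw [← h, Multiset.card_singleton] at this
    omega
  · have := hC.2 _ h {e} le_rfl (Multiset.singleton_ne_zero e)
    omega

/-- A multiset violating the sparsity count contains a circuit, provided that no single edge
spans too few vertices. -/
theorem exists_isCircuit_le {V : Type*} [DecidableEq V] {k ℓ : ℕ} (F : Multiset (Finset V))
    (hF : F ≠ 0) (hcard : k * (spanned F).card < F.card + ℓ)
    (hloop : ∀ e ∈ F, ℓ ≤ k * (spanned {e}).card) : ∃ C ≤ F, IsCircuit k ℓ C := by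
  induction F using Multiset.strongInductionOn with
  | _ F ih =>
    by_cases hex : ∃ G < F, G ≠ 0 ∧ k * (spanned G).card < G.card + ℓ
    · obtain ⟨G, hGF, hG, hGc⟩ := hex
      obtain ⟨C, hC, hC'⟩ := ih G hGF hG hGc
        fun e he => hloop e (Multiset.mem_of_le hGF.le he)
      exact ⟨C, hC.trans hGF.le, hC'⟩
    · push Not at hex
      refine ⟨F, le_rfl, ?_, fun G hG H hH hH0 => hex H (hH.trans_lt hG) hH0⟩
      obtain ⟨e, he⟩ := Multiset.exists_mem_of_ne_zero hF
      have hce := Multiset.card_erase_add_one he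
      by_cases h0 : F.erase e = 0
      · have h1 := hloop e he
        have h2 := card_spanned_mono (Multiset.singleton_le.2 he) k
        rw [h0, Multiset.card_zero] at hce
        omega
      · have h1 := hex _ (Multiset.erase_lt.2 he) h0
        have h2 := card_spanned_mono (Multiset.erase_le e F) k
        omega

/-- Elimination for two circuits of possibly different levels. -/
theorem IsCircuit.exists_isCircuit_le_union_erase {V : Type*} [DecidableEq V] {k ℓ ℓ' : ℕ}
    {A B : Multiset (Finset V)} (hA : IsCircuit k ℓ A) (hB : IsCircuit k ℓ' B) (hℓ : ℓ ≤ ℓ')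
    (hBA : ¬ B ≤ A) {y : Finset V} (hyA : y ∈ A) (hyB : y ∈ B) :
    ∃ C ≤ (A ∪ B).erase y, IsCircuit k ℓ C := by
  have hlt : A ∩ B < B := lt_of_le_of_ne Multiset.inter_le_right
    fun h => hBA (h ▸ Multiset.inter_le_left)
  have hne : A ∩ B ≠ 0 :=
    fun h => Multiset.notMem_zero y (h ▸ Multiset.mem_inter.2 ⟨hyA, hyB⟩)
  have hs := hB.2 _ hlt _ le_rfl hne
  have hsub := Nat.mul_le_mul_left k (card_spanned_union_add_card_spanned_inter_le A B)
  rw [mul_add, mul_add] at hsub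
  have hyU : y ∈ A ∪ B := Multiset.mem_union.2 (Or.inl hyA)
  have hce := Multiset.card_erase_add_one hyU
  have hc : (A ∪ B).card + (A ∩ B).card = A.card + B.card := by
    rw [← Multiset.card_add, Multiset.union_add_inter, Multiset.card_add]
  have hmono := card_spanned_mono (Multiset.erase_le y (A ∪ B)) k
  have hA1 := hA.1
  have hB1 := hB.1
  refine exists_isCircuit_le _ ?_ (by omega) ?_
  · intro h0
    have h1 := Multiset.card_lt_card hlt
    have h2 : 0 < (A ∩ B).card := Multiset.card_pos.2 hne
    have h3 := Multiset.card_le_card (Multiset.le_union_right (s := A) (t := B))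
    rw [h0, Multiset.card_zero] at hce
    omega
  · intro e he
    rcases Multiset.mem_union.1 (Multiset.mem_of_mem_erase he) with h | h
    · exact hA.le_card_of_mem h
    · exact hℓ.trans (hB.le_card_of_mem h)

section Graded

variable {V : Type*} [DecidableEq V] {k s : ℕ} {ℓv : ℕ → ℕ} {gr : ℕ → Multiset (Finset V)}

theorem mem_CGE_self {C : Multiset (Finset V)} :
    C ∈ CGE k ℓv gr s s ↔ C ≤ gr s ∧ IsCircuit k (ℓv s) C := by
  rw [CGE, dif_pos le_rfl, Set.mem_ofPred_eq]

theorem mem_CGE_of_lt {i : ℕ} (hi : i < s) {C : Multiset (Finset V)} :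
    C ∈ CGE k ℓv gr s i ↔ C ∈ CGE k ℓv gr s (i + 1) ∨
      (C ≤ gr i ∧ IsCircuit k (ℓv i) C ∧ ∀ D ∈ CGE k ℓv gr s (i + 1), ¬ D ≤ C) := by
  rw [CGE, dif_neg (not_le.2 hi), Set.mem_ofPred_eq]

theorem CGE_anti {i j : ℕ} (hij : i ≤ j) (hj : j ≤ s) :
    CGE k ℓv gr s j ⊆ CGE k ℓv gr s i := by
  induction j, hij using Nat.le_induction with
  | base => exact subset_rfl
  | succ j _ ih => exact fun C hC => ih (by omega) ((mem_CGE_of_lt (by omega)).2 (Or.inl hC))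

theorem exists_level_of_mem_CGE {i : ℕ} (hi : i ≤ s) {C : Multiset (Finset V)}
    (hC : C ∈ CGE k ℓv gr s i) :
    ∃ j, i ≤ j ∧ j ≤ s ∧ C ∈ CGE k ℓv gr s j ∧ C ≤ gr j ∧ IsCircuit k (ℓv j) C ∧
      (j < s → ∀ D ∈ CGE k ℓv gr s (j + 1), ¬ D ≤ C) := by
  induction hi using Nat.decreasingInduction with
  | self =>
    obtain ⟨h1, h2⟩ := mem_CGE_self.1 hC
    exact ⟨s, le_rfl, le_rfl, hC, h1, h2, fun h => absurd h (lt_irrefl s)⟩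
  | of_succ i hi ih =>
    rcases (mem_CGE_of_lt hi).1 hC with h | ⟨h1, h2, h3⟩
    · obtain ⟨j, hj, hrest⟩ := ih h
      exact ⟨j, by omega, hrest⟩
    · exact ⟨i, le_rfl, hi.le, hC, h1, h2, fun _ => h3⟩

theorem IsCircuit.exists_mem_CGE_le {i : ℕ} (hi : i ≤ s) {C : Multiset (Finset V)}
    (hC : IsCircuit k (ℓv i) C) (hCi : C ≤ gr i) : ∃ D ∈ CGE k ℓv gr s i, D ≤ C := by
  rcases hi.eq_or_lt with rfl | hlt
  · exact ⟨C, mem_CGE_self.2 ⟨hCi, hC⟩, le_rfl⟩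
  · by_cases h : ∃ D ∈ CGE k ℓv gr s (i + 1), D ≤ C
    · obtain ⟨D, hD, hDC⟩ := h
      exact ⟨D, CGE_anti (Nat.le_succ i) hlt hD, hDC⟩
    · push Not at h
      exact ⟨C, (mem_CGE_of_lt hlt).2 (Or.inr ⟨hCi, hC, h⟩), le_rfl⟩

end Graded

/-- Circuit elimination for the graded circuit family `𝓒 = 𝓒_{≥ 1}`: if `Cᵢ ≠ Cⱼ` are
members of `𝓒` sharing a common edge `y`, then `(Cᵢ ∪ Cⱼ) - y` contains a member
of `𝓒`. -/
theorem cge_circuit_elimination {V : Type*} [DecidableEq V] (k s : ℕ) (hs : 1 ≤ s)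
    (ℓv : ℕ → ℕ) (gr : ℕ → Multiset (Finset V))
    (hl : ∀ i, 1 ≤ i → i < s → ℓv i < ℓv (i + 1))
    (hgr : ∀ i, 1 ≤ i → i < s → gr (i + 1) < gr i)
    (Ci Cj : Multiset (Finset V)) (hCi : Ci ∈ CGE k ℓv gr s 1) (hCj : Cj ∈ CGE k ℓv gr s 1)
    (hne : Ci ≠ Cj) (y : Finset V) (hyi : y ∈ Ci) (hyj : y ∈ Cj) :
    ∃ C ∈ CGE k ℓv gr s 1, C ≤ (Ci ∪ Cj).erase y := by
  have hlmono : ∀ i j, 1 ≤ i → i ≤ j → j ≤ s → ℓv i ≤ ℓv j := by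
    intro i j hi hij
    induction j, hij using Nat.le_induction with
    | base => exact fun _ => le_rfl
    | succ j hij ih => exact fun hj => (ih (by omega)).trans (hl j (by omega) hj).le
  have hgmono : ∀ i j, 1 ≤ i → i ≤ j → j ≤ s → gr j ≤ gr i := by
    intro i j hi hij
    induction j, hij using Nat.le_induction with
    | base => exact fun _ => le_rfl
    | succ j hij ih => exact fun hj => (hgr j (by omega) hj).le.trans (ih (by omega))
  obtain ⟨i, hi1, his, hmi, hgi, hci, hni⟩ := exists_level_of_mem_CGE hs hCi
  obtain ⟨j, hj1, hjs, hmj, hgj, hcj, hnj⟩ := exists_level_of_mem_CGE hs hCj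
  wlog hij : i ≤ j generalizing i j Ci Cj
  · rw [Multiset.union_comm]
    exact this Cj Ci hCj hCi hne.symm hyj hyi j hj1 hjs hmj hgj hcj hnj
      i hi1 his hmi hgi hci hni (by omega)
  have hnle : ¬ Cj ≤ Ci := by
    rcases hij.eq_or_lt with rfl | hlt
    · exact fun h => hne (hcj.eq_of_le hci (fun h0 => Multiset.notMem_zero y (h0 ▸ hyj)) h).symm
    · exact hni (hlt.trans_le hjs) Cj (CGE_anti hlt hjs hmj)
  obtain ⟨C, hCle, hC⟩ := hci.exists_isCircuit_le_union_erase hcj (hlmono i j hi1 hij hjs)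
    hnle hyi hyj
  obtain ⟨D, hD, hDC⟩ := hC.exists_mem_CGE_le his
    ((hCle.trans (Multiset.erase_le _ _)).trans
      (Multiset.union_le hgi (hgj.trans (hgmono i j hi1 hij hjs))))
  exact ⟨D, CGE_anti hi1 his hD, hDC.trans hCle⟩
end
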